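/- Let M be a Gotzmann set of monomials of degree t in S and set d_i = |M^i| for 0 ≤ i ≤ t (with d_{−1} = d_{t+1} = 0). If d_q^{<n−2>} < d_{q−1} for some 1 ≤ q ≤ t, then either (d_q + 1)^{<n−2>} > d_{q−1} − 1 or d_q + 1 > d_{q+1}^{<n−2>}. -/

import Mathlib

open scoped Classical
open Finset

noncomputable section

/-- The monomials of degree `t` in `n` variables, identified with exponent vectors. -/
def degMon (n t : ℕ) : Finset (Fin n → ℕ) := Finset.Nat.antidiagonalTuple n t

/-- The exponent of `x_1` in a monomial. -/
def x1exp {n : ℕ} (m : Fin n → ℕ) : ℕ := if h : 0 < n then m ⟨0, h⟩ else 0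

/-- `lexLt u v` : `u` is lexicographically smaller than `v` as monomials
(with `x_1 > x_2 > ... > x_n`), i.e. `v > u`. -/
def lexLt {n : ℕ} (u v : Fin n → ℕ) : Prop :=
  ∃ i : Fin n, (∀ j : Fin n, j < i → u j = v j) ∧ u i < v i

/-- `M` is a lexsegment set inside the ground set `G` of monomials. -/
def IsLexSeg {n : ℕ} (G M : Finset (Fin n → ℕ)) : Prop :=
  M ⊆ G ∧ ∀ m ∈ M, ∀ v ∈ G, lexLt m v → v ∈ M

/-- The lexsegment set consisting of the top `d` monomials of `G` in the lex order. -/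
def lexSeg {n : ℕ} (G : Finset (Fin n → ℕ)) (d : ℕ) : Finset (Fin n → ℕ) :=
  G.filter (fun m => (G.filter (fun v => m = v ∨ lexLt m v)).card ≤ d)

/-- `S_1 · M` : all monomials `u * m` with `u` a variable and `m ∈ M`. -/
def S1mul (n : ℕ) (M : Finset (Fin n → ℕ)) : Finset (Fin n → ℕ) :=
  Finset.univ.biUnion (fun i : Fin n => M.image (fun m => m + Pi.single i 1))

/-- `S'_1 · M` : all monomials `x_i * m` with `2 ≤ i ≤ n` and `m ∈ M`. -/
def S1'mul (n : ℕ) (M : Finset (Fin n → ℕ)) : Finset (Fin n → ℕ) :=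
  (Finset.univ.filter (fun i : Fin n => (i : ℕ) ≠ 0)).biUnion
    (fun i => M.image (fun m => m + Pi.single i 1))

/-- `d^{<k>}` : the number of monomials obtained by multiplying each member of the
lexsegment set of `d` monomials of a fixed degree in `k+1` variables by each of the
`k+1` variables.  (We realize it in degree `d`, where the lexsegment set exists;
the number is independent of the chosen degree.  Also `0^{<k>} = 0`.) -/
def growth (d k : ℕ) : ℕ := (S1mul (k + 1) (lexSeg (degMon (k + 1) d) d)).card

/-- The monomials of `R_t` where `R = S/(x_1^a)` : degree-`t` monomials whose
`x_1`-exponent is at most `a - 1`. -/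
def RMon (n a t : ℕ) : Finset (Fin n → ℕ) :=
  (degMon n t).filter (fun m => x1exp m < a)

/-- `R_1 · M` : the monomials of `S_1 · M` not divisible by `x_1^a`. -/
def R1mul (n a : ℕ) (M : Finset (Fin n → ℕ)) : Finset (Fin n → ℕ) :=
  (S1mul n M).filter (fun m => x1exp m < a)

/-- `d_{n,t}` : the size of `R_1 · L` for the lexsegment set `L` of `d` monomials in `R_t`. -/
def dnt (n a t d : ℕ) : ℕ := (R1mul n a (lexSeg (RMon n a t) d)).card

/-- `M^i` : the monomials of `M` divisible by `x_1^i` but not by `x_1^{i+1}`. -/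
def comp {n : ℕ} (M : Finset (Fin n → ℕ)) (i : ℕ) : Finset (Fin n → ℕ) :=
  M.filter (fun m => x1exp m = i)

/-- `I(M)` : the smallest `i` such that `M^i ≠ ∅`. -/
def Imon {n : ℕ} (M : Finset (Fin n → ℕ)) : ℕ := sInf {i | (comp M i).Nonempty}

/-- `M` is Gotzmann in `S_t`. -/
def GotzmannS (n t : ℕ) (M : Finset (Fin n → ℕ)) : Prop :=
  (S1mul n (lexSeg (degMon n t) M.card)).card = (S1mul n M).card

/-- `M` is Gotzmann in `R_t`, `R = S/(x_1^a)`. -/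
def GotzmannR (n a t : ℕ) (M : Finset (Fin n → ℕ)) : Prop :=
  (R1mul n a (lexSeg (RMon n a t) M.card)).card = (R1mul n a M).card

/-- The monomials of degree `t` of `S' = F[x_2,...,x_n]`, viewed inside the `n`
variables as the monomials with `x_1`-exponent `0`. -/
def SpMon (n t : ℕ) : Finset (Fin n → ℕ) :=
  (degMon n t).filter (fun m => x1exp m = 0)

/-- `M` is Gotzmann in `S' = F[x_2,...,x_n]` (in degree `t`). -/
def GotzmannSp (n t : ℕ) (M : Finset (Fin n → ℕ)) : Prop :=
  (S1'mul n (lexSeg (SpMon n t) M.card)).card = (S1'mul n M).card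

/-- Dividing a monomial by the pure power of `x_1` it contains: set the first exponent to `0`. -/
def clearX1 {n : ℕ} (m : Fin n → ℕ) : Fin n → ℕ :=
  fun j => if (j : ℕ) = 0 then 0 else m j

/-- `M^i / x_1` : the monomials `m` of `S'` with `m * x_1^i ∈ M^i` (applied to `M = M^i`). -/
def divX1 {n : ℕ} (M : Finset (Fin n → ℕ)) : Finset (Fin n → ℕ) :=
  M.image clearX1

/-- `u · M` : the monomials `u * m` with `m ∈ M`. -/
def mulMon {n : ℕ} (u : Fin n → ℕ) (M : Finset (Fin n → ℕ)) : Finset (Fin n → ℕ) :=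
  M.image (fun m => u + m)

/-- The set `B` of degree-`t` monomials of `S` divisible by `x_1^a`. -/
def Bset (n a t : ℕ) : Finset (Fin n → ℕ) :=
  (degMon n t).filter (fun m => a ≤ x1exp m)

theorem lexLt_iff {n : ℕ} (u v : Fin n → ℕ) : lexLt u v ↔ toLex u < toLex v := Iff.rfl

theorem lexLt_irrefl {n : ℕ} (u : Fin n → ℕ) : ¬ lexLt u u := by
  rw [lexLt_iff]; exact lt_irrefl _

theorem lexLt_trans {n : ℕ} {u v w : Fin n → ℕ} (h : lexLt u v) (h' : lexLt v w) :
    lexLt u w := by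
  rw [lexLt_iff] at *; exact lt_trans h h'

theorem lexLt_tri {n : ℕ} (u v : Fin n → ℕ) : lexLt u v ∨ u = v ∨ lexLt v u := by
  simp only [lexLt_iff]
  rcases lt_trichotomy (toLex u) (toLex v) with h | h | h
  · exact Or.inl h
  · exact Or.inr (Or.inl (toLex.injective h))
  · exact Or.inr (Or.inr h)

theorem lexSeg_isLexSeg {n : ℕ} (G : Finset (Fin n → ℕ)) (d : ℕ) : IsLexSeg G (lexSeg G d) := by
  refine ⟨filter_subset _ _, ?_⟩
  intro m hm v hv hlt
  simp only [lexSeg, mem_filter] at hm ⊢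
  refine ⟨hv, le_trans (card_le_card ?_) hm.2⟩
  intro w hw
  simp only [mem_filter] at hw ⊢
  refine ⟨hw.1, Or.inr ?_⟩
  rcases hw.2 with rfl | h
  · exact hlt
  · exact lexLt_trans hlt h

theorem lexSeg_card {n : ℕ} (G : Finset (Fin n → ℕ)) (d : ℕ) :
    (lexSeg G d).card = min d G.card := by
  set r : (Fin n → ℕ) → ℕ := fun m => (G.filter (fun v => m = v ∨ lexLt m v)).card with hr
  have hlt : ∀ a ∈ G, ∀ b ∈ G, lexLt a b → r b < r a := by
    intro a ha b hb hab
    apply card_lt_card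
    rw [Finset.ssubset_iff_of_subset]
    · refine ⟨a, by simp [ha], ?_⟩
      simp only [mem_filter, not_and, not_or]
      intro _
      constructor
      · rintro rfl; exact lexLt_irrefl _ hab
      · intro h; exact lexLt_irrefl _ (lexLt_trans h hab)
    · intro w hw
      simp only [mem_filter] at hw ⊢
      refine ⟨hw.1, Or.inr ?_⟩
      rcases hw.2 with rfl | h
      · exact hab
      · exact lexLt_trans hab h
  have hinj : Set.InjOn r G := by
    intro a ha b hb hab
    rcases lexLt_tri a b with h | h | h
    · have := hlt a ha b hb h; omega
    · exact h
    · have := hlt b hb a ha h; omega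
  have himg : G.image r = Finset.Icc 1 G.card := by
    apply Finset.eq_of_subset_of_card_le
    · intro x hx
      obtain ⟨m, hm, rfl⟩ := mem_image.1 hx
      rw [Finset.mem_Icc]
      refine ⟨card_pos.2 ⟨m, by simp [hm]⟩, card_le_card (filter_subset _ _)⟩
    · rw [card_image_of_injOn hinj]; simp
  have h2 : (lexSeg G d).image r = Finset.Icc 1 (min d G.card) := by
    have : (lexSeg G d).image r = (G.image r).filter (· ≤ d) := by
      ext x
      simp only [lexSeg, mem_image, mem_filter]
      constructor
      · rintro ⟨a, ⟨ha, hd⟩, rfl⟩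
        exact ⟨⟨a, ha, rfl⟩, hd⟩
      · rintro ⟨⟨a, ha, rfl⟩, hd⟩
        exact ⟨a, ⟨ha, hd⟩, rfl⟩
    rw [this, himg]
    ext x
    simp only [mem_filter, Finset.mem_Icc]
    omega
  rw [← card_image_of_injOn (f := r) (s := lexSeg G d), h2]
  · simp
  · exact hinj.mono (by intro x hx; exact (mem_filter.1 hx).1)

theorem IsLexSeg.subset_of_card {n : ℕ} {G A B : Finset (Fin n → ℕ)} (hA : IsLexSeg G A)
    (hB : IsLexSeg G B) (h : A.card ≤ B.card) : A ⊆ B := by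
  by_contra hc
  obtain ⟨a, haA, haB⟩ := Finset.not_subset.1 hc
  have : B ⊆ A := by
    intro b hb
    rcases lexLt_tri a b with h | h | h
    · exact hA.2 a haA b (hB.1 hb) h
    · exact h ▸ haA
    · exact absurd (hB.2 b hb a (hA.1 haA) h) haB
  have := Finset.eq_of_subset_of_card_le this h
  exact haB (this ▸ haA)

theorem IsLexSeg.eq_of_card {n : ℕ} {G A B : Finset (Fin n → ℕ)} (hA : IsLexSeg G A)
    (hB : IsLexSeg G B) (h : A.card = B.card) : A = B :=
  (hA.subset_of_card hB h.le).antisymm (hB.subset_of_card hA h.ge)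

theorem IsLexSeg.eq_lexSeg {n : ℕ} {G A : Finset (Fin n → ℕ)} (hA : IsLexSeg G A) :
    A = lexSeg G A.card := by
  apply hA.eq_of_card (lexSeg_isLexSeg _ _)
  rw [lexSeg_card]
  exact (min_eq_left (card_le_card hA.1)).symm

theorem IsLexSeg.card_union {n : ℕ} {G A B : Finset (Fin n → ℕ)} (hA : IsLexSeg G A)
    (hB : IsLexSeg G B) : (A ∪ B).card = max A.card B.card := by
  rcases le_total A.card B.card with h | h
  · rw [Finset.union_eq_right.2 (hA.subset_of_card hB h), max_eq_right h]
  · rw [Finset.union_eq_left.2 (hB.subset_of_card hA h), max_eq_left h]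

theorem mem_degMon {n t : ℕ} {m : Fin n → ℕ} : m ∈ degMon n t ↔ ∑ i, m i = t := by
  simp [degMon, Finset.Nat.mem_antidiagonalTuple]

theorem mem_S1mul {n : ℕ} {M : Finset (Fin n → ℕ)} {x : Fin n → ℕ} :
    x ∈ S1mul n M ↔ ∃ k, ∃ m ∈ M, m + Pi.single k 1 = x := by
  simp [S1mul]

theorem sum_add_single {n : ℕ} (m : Fin n → ℕ) (k : Fin n) (a : ℕ) :
    ∑ i, (m + Pi.single k a : Fin n → ℕ) i = ∑ i, m i + a := by
  simp [Finset.sum_add_distrib, Finset.sum_pi_single']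

theorem S1mul_subset {n t : ℕ} {M : Finset (Fin n → ℕ)} (h : M ⊆ degMon n t) :
    S1mul n M ⊆ degMon n (t + 1) := by
  intro x hx
  obtain ⟨k, m, hm, rfl⟩ := mem_S1mul.1 hx
  rw [mem_degMon, sum_add_single, mem_degMon.1 (h hm)]

theorem S1mul_mono {n : ℕ} {M N : Finset (Fin n → ℕ)} (h : M ⊆ N) : S1mul n M ⊆ S1mul n N := by
  intro x hx
  obtain ⟨k, m, hm, rfl⟩ := mem_S1mul.1 hx
  exact mem_S1mul.2 ⟨k, m, h hm, rfl⟩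

theorem IsLexSeg.S1mul {n t : ℕ} {L : Finset (Fin n → ℕ)} (hL : IsLexSeg (degMon n t) L) :
    IsLexSeg (degMon n (t + 1)) (S1mul n L) := by
  refine ⟨S1mul_subset hL.1, ?_⟩
  intro x hx v hv hlt
  obtain ⟨k, m, hm, rfl⟩ := mem_S1mul.1 hx
  have hvs := mem_degMon.1 hv
  have hms := mem_degMon.1 (hL.1 hm)
  -- last variable of v
  have hne : (univ.filter (fun i => 0 < v i)).Nonempty := by
    by_contra hc
    rw [Finset.not_nonempty_iff_eq_empty] at hc
    have : ∑ i, v i = 0 := by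
      apply Finset.sum_eq_zero
      intro i _
      by_contra h0
      have : i ∈ univ.filter (fun i => 0 < v i) := by simp; omega
      rw [hc] at this; simp at this
    omega
  obtain ⟨l, hl, hmax⟩ : ∃ l, 0 < v l ∧ ∀ j, l < j → v j = 0 := by
    refine ⟨_, (mem_filter.1 (Finset.max'_mem _ hne)).2, ?_⟩
    intro j hj
    by_contra h0
    have := Finset.le_max' (univ.filter (fun i => 0 < v i)) j (by simp; omega)
    exact absurd hj (not_lt.2 this)
  obtain ⟨m', rfl⟩ : ∃ m' : Fin n → ℕ, v = m' + Pi.single l 1 := by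
    refine ⟨v - Pi.single l 1, ?_⟩
    funext j
    by_cases hj : j = l
    · subst hj; simp; omega
    · simp [hj]
  rw [sum_add_single] at hvs
  have hs' : ∑ i, m' i = t := by omega
  refine mem_S1mul.2 ⟨l, m', ?_, rfl⟩
  rcases lexLt_tri m m' with h | h | h
  · exact hL.2 m hm m' (mem_degMon.2 hs') h
  · exact h ▸ hm
  exfalso
  obtain ⟨p, hp, hpl⟩ := h
  obtain ⟨i, hi, hil⟩ := hlt
  have hx : ∀ j, m j ≤ (m + Pi.single k 1 : Fin n → ℕ) j := fun j => by simp
  have hv1 : ∀ j, j ≠ l → (m' + Pi.single l 1 : Fin n → ℕ) j = m' j := fun j hj => by simp [hj]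
  have hv2 : (m' + Pi.single l 1 : Fin n → ℕ) l = m' l + 1 := by simp
  rcases lt_or_ge l p with hlp | hlp
  · have : ∑ i, m' i < ∑ i, m i := by
      apply Finset.sum_lt_sum
      · intro j _
        rcases lt_or_ge j p with h | h
        · exact (hp j h).le
        · have := hmax j (lt_of_lt_of_le hlp h)
          rw [hv1 j (ne_of_gt (lt_of_lt_of_le hlp h))] at this
          omega
      · exact ⟨p, mem_univ _, hpl⟩
    omega
  · have h1 : ∀ j, j < p → (m' + Pi.single l 1 : Fin n → ℕ) j ≤ (m + Pi.single k 1 : Fin n → ℕ) j := by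
      intro j hj
      rw [hv1 j (ne_of_lt (lt_of_lt_of_le hj hlp)), hp j hj]; exact hx j
    have h2 : (m' + Pi.single l 1 : Fin n → ℕ) p ≤ m' p + 1 := by
      by_cases h : p = l
      · subst h; rw [hv2]
      · rw [hv1 p h]; omega
    have h3 := hx p
    have hpi : p < i := by
      rcases lt_trichotomy i p with h | h | h
      · have := h1 i h; omega
      · subst h; omega
      · exact h
    have h4 := hi p hpi
    have : p = l := by
      by_contra h
      have := hv1 p h
      omega
    subst this
    have := hmax i hpi
    omega

/-- slices -/
def slc {n : ℕ} (M : Finset (Fin (n + 1) → ℕ)) (i : Fin (n + 1)) (j : ℕ) : Finset (Fin n → ℕ) :=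
  (M.filter (fun m => m i = j)).image (fun m => i.removeNth m)

theorem mem_slc {n : ℕ} {M : Finset (Fin (n + 1) → ℕ)} {i : Fin (n + 1)} {j : ℕ}
    {u : Fin n → ℕ} : u ∈ slc M i j ↔ (i.insertNth j u : Fin (n + 1) → ℕ) ∈ M := by
  simp only [slc, mem_image, mem_filter]
  constructor
  · rintro ⟨m, ⟨hm, rfl⟩, rfl⟩
    simpa using hm
  · intro h
    exact ⟨_, ⟨h, by simp⟩, by simp⟩

theorem insertNth_mem_degMon {n t : ℕ} {i : Fin (n + 1)} {j : ℕ} {u : Fin n → ℕ} :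
    (i.insertNth j u : Fin (n + 1) → ℕ) ∈ degMon (n + 1) t ↔ j + ∑ k, u k = t := by
  rw [mem_degMon, Fin.sum_univ_succAbove _ i]
  simp

theorem slc_subset {n t : ℕ} {M : Finset (Fin (n + 1) → ℕ)} (h : M ⊆ degMon (n + 1) t)
    (i : Fin (n + 1)) (j : ℕ) : slc M i j ⊆ degMon n (t - j) := by
  intro u hu
  have := insertNth_mem_degMon.1 (h (mem_slc.1 hu))
  rw [mem_degMon]; omega

theorem slc_empty {n t : ℕ} {M : Finset (Fin (n + 1) → ℕ)} (h : M ⊆ degMon (n + 1) t)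
    (i : Fin (n + 1)) (j : ℕ) (hj : t < j) : slc M i j = ∅ := by
  rw [Finset.eq_empty_iff_forall_notMem]
  intro u hu
  have := insertNth_mem_degMon.1 (h (mem_slc.1 hu))
  omega

theorem sum_slc {n t : ℕ} {M : Finset (Fin (n + 1) → ℕ)} (h : M ⊆ degMon (n + 1) t)
    (i : Fin (n + 1)) (φ : (Fin (n + 1) → ℕ) → ℕ) :
    ∑ m ∈ M, φ m = ∑ j ∈ range (t + 1), ∑ u ∈ slc M i j, φ (i.insertNth j u) := by
  rw [← Finset.sum_fiberwise_of_maps_to (s := M) (t := range (t + 1)) (g := fun m => m i)]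
  · apply Finset.sum_congr rfl
    intro j _
    symm
    apply Finset.sum_bij (fun u _ => (i.insertNth j u : Fin (n + 1) → ℕ))
    · intro u hu
      simp [mem_slc.1 hu]
    · intro a _ b _ hab
      have := congrArg (fun m => i.removeNth m) hab
      simpa using this
    · intro b hb
      obtain ⟨hb, rfl⟩ := mem_filter.1 hb
      exact ⟨i.removeNth b, by rw [mem_slc]; simpa using hb, by simp⟩
    · intros; rfl
  · intro m hm
    have := mem_degMon.1 (h hm)
    have h2 : m i ≤ ∑ k, m k := Finset.single_le_sum (fun _ _ => Nat.zero_le _) (mem_univ i)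
    simp; omega

theorem card_slc {n t : ℕ} {M : Finset (Fin (n + 1) → ℕ)} (h : M ⊆ degMon (n + 1) t)
    (i : Fin (n + 1)) : M.card = ∑ j ∈ range (t + 1), (slc M i j).card := by
  have := sum_slc h i (fun _ => 1)
  simpa using this

theorem insertNth_add_single {n : ℕ} (i : Fin (n + 1)) (j a : ℕ) (u : Fin n → ℕ) (k : Fin n) :
    (i.insertNth j (u + Pi.single k a) : Fin (n + 1) → ℕ)
      = i.insertNth j u + Pi.single (i.succAbove k) a := by
  ext l
  rcases Fin.eq_self_or_eq_succAbove i l with rfl | ⟨l', rfl⟩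
  · simp [(Fin.succAbove_ne l k).symm]
  · by_cases h : l' = k
    · subst h; simp
    · simp [h]

theorem insertNth_add_self {n : ℕ} (i : Fin (n + 1)) (j a : ℕ) (u : Fin n → ℕ) :
    (i.insertNth (j + a) u : Fin (n + 1) → ℕ) = i.insertNth j u + Pi.single i a := by
  ext l
  rcases Fin.eq_self_or_eq_succAbove i l with rfl | ⟨l', rfl⟩
  · simp
  · simp

theorem insertNth_inj {n : ℕ} (i : Fin (n + 1)) {j j' : ℕ} {u u' : Fin n → ℕ}
    (h : (i.insertNth j u : Fin (n + 1) → ℕ) = i.insertNth j' u') : j = j' ∧ u = u' := by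
  constructor
  · have := congrFun h i; simpa using this
  · have := congrArg (fun m => i.removeNth m) h
    simpa using this

theorem slc_S1mul_zero {n : ℕ} (M : Finset (Fin (n + 1) → ℕ)) (i : Fin (n + 1)) :
    slc (S1mul (n + 1) M) i 0 = S1mul n (slc M i 0) := by
  ext u
  rw [mem_slc, mem_S1mul, mem_S1mul]
  constructor
  · rintro ⟨k, m, hm, h⟩
    rcases Fin.eq_self_or_eq_succAbove i k with rfl | ⟨k', rfl⟩
    · have := congrFun h k; simp at this
    · have e : m = i.insertNth (m i) (i.removeNth m) := by simp
      rw [e, ← insertNth_add_single] at h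
      obtain ⟨h1, h2⟩ := insertNth_inj _ h
      refine ⟨k', i.removeNth m, ?_, h2⟩
      rw [mem_slc, ← h1, ← e]; exact hm
  · rintro ⟨k, m, hm, rfl⟩
    exact ⟨i.succAbove k, _, mem_slc.1 hm, (insertNth_add_single _ _ _ _ _).symm⟩

theorem slc_S1mul_succ {n : ℕ} (M : Finset (Fin (n + 1) → ℕ)) (i : Fin (n + 1)) (j : ℕ) :
    slc (S1mul (n + 1) M) i (j + 1) = slc M i j ∪ S1mul n (slc M i (j + 1)) := by
  ext u
  rw [mem_slc, mem_S1mul, mem_union, mem_S1mul]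
  constructor
  · rintro ⟨k, m, hm, h⟩
    have e : m = i.insertNth (m i) (i.removeNth m) := by simp
    rcases Fin.eq_self_or_eq_succAbove i k with rfl | ⟨k', rfl⟩
    · left
      rw [e, ← insertNth_add_self] at h
      obtain ⟨h1, h2⟩ := insertNth_inj _ h
      have h1 : m k = j := by omega
      rw [mem_slc, ← h1, ← h2, ← e]; exact hm
    · right
      rw [e, ← insertNth_add_single] at h
      obtain ⟨h1, h2⟩ := insertNth_inj _ h
      refine ⟨k', i.removeNth m, ?_, h2⟩
      rw [mem_slc, ← h1, ← e]; exact hm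
  · rintro (h | ⟨k, m, hm, rfl⟩)
    · exact ⟨i, _, mem_slc.1 h, (insertNth_add_self _ _ _ _).symm⟩
    · exact ⟨i.succAbove k, _, mem_slc.1 hm, (insertNth_add_single _ _ _ _ _).symm⟩

theorem card_S1mul_slc {n t : ℕ} {M : Finset (Fin (n + 1) → ℕ)} (h : M ⊆ degMon (n + 1) t)
    (i : Fin (n + 1)) : (S1mul (n + 1) M).card = (S1mul n (slc M i 0)).card +
      ∑ j ∈ range (t + 1), (slc M i j ∪ S1mul n (slc M i (j + 1))).card := by
  rw [card_slc (S1mul_subset h) i, Finset.sum_range_succ', slc_S1mul_zero, add_comm]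
  simp_rw [slc_S1mul_succ]

theorem lexLt_insertNth {n : ℕ} (k : Fin (n + 1)) (a : ℕ) (u v : Fin n → ℕ) :
    lexLt (k.insertNth a u : Fin (n + 1) → ℕ) (k.insertNth a v) ↔ lexLt u v := by
  constructor
  · rintro ⟨i, hi, hl⟩
    rcases Fin.eq_self_or_eq_succAbove k i with rfl | ⟨i', rfl⟩
    · simp at hl
    · refine ⟨i', ?_, by simpa using hl⟩
      intro j hj
      simpa using hi (k.succAbove j) ((Fin.strictMono_succAbove k) hj)
  · rintro ⟨i, hi, hl⟩
    refine ⟨k.succAbove i, ?_, by simpa using hl⟩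
    intro j hj
    rcases Fin.eq_self_or_eq_succAbove k j with rfl | ⟨j', rfl⟩
    · simp
    · simpa using hi j' ((Fin.strictMono_succAbove k).lt_iff_lt.1 hj)

/-- assemble slices -/
def bld {n : ℕ} (t : ℕ) (i : Fin (n + 1)) (A : ℕ → Finset (Fin n → ℕ)) :
    Finset (Fin (n + 1) → ℕ) :=
  (degMon (n + 1) t).filter (fun m => i.removeNth m ∈ A (m i))

theorem bld_subset {n : ℕ} (t : ℕ) (i : Fin (n + 1)) (A : ℕ → Finset (Fin n → ℕ)) :
    bld t i A ⊆ degMon (n + 1) t := filter_subset _ _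

theorem slc_bld {n t : ℕ} (i : Fin (n + 1)) {A : ℕ → Finset (Fin n → ℕ)} {j : ℕ} (hj : j ≤ t)
    (hA : A j ⊆ degMon n (t - j)) : slc (bld t i A) i j = A j := by
  ext u
  rw [mem_slc, bld, mem_filter, insertNth_mem_degMon]
  simp only [Fin.removeNth_insertNth, Fin.insertNth_apply_same]
  constructor
  · exact fun h => h.2
  · intro h
    have := mem_degMon.1 (hA h)
    exact ⟨by omega, h⟩

theorem S1mul_empty (n : ℕ) : S1mul n ∅ = ∅ := by
  ext x; simp [mem_S1mul]

theorem card_S1mul_bld {n t : ℕ} (i : Fin (n + 1)) {A : ℕ → Finset (Fin n → ℕ)}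
    (hA : ∀ j, IsLexSeg (degMon n (t - j)) (A j)) (hA' : A (t + 1) = ∅) :
    (S1mul (n + 1) (bld t i A)).card = (S1mul n (A 0)).card +
      ∑ j ∈ range (t + 1), max (A j).card (S1mul n (A (j + 1))).card := by
  rw [card_S1mul_slc (bld_subset t i A) i, slc_bld i (Nat.zero_le _) (hA 0).1]
  congr 1
  apply Finset.sum_congr rfl
  intro j hj
  have hj : j ≤ t := by simp at hj; omega
  rw [slc_bld i hj (hA j).1]
  rcases hj.lt_or_eq with h | rfl
  · rw [slc_bld i h (hA _).1]
    have h2 := (hA (j + 1)).S1mul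
    rw [show t - (j + 1) + 1 = t - j by omega] at h2
    exact (hA j).card_union h2
  · rw [hA', slc_empty (bld_subset _ _ _) _ _ (Nat.lt_succ_self _), S1mul_empty]
    simp

/-- Macaulay -/
def Mac (n : ℕ) : Prop := ∀ (t : ℕ) (L M : Finset (Fin n → ℕ)), IsLexSeg (degMon n t) L →
  M ⊆ degMon n t → L.card ≤ M.card → (S1mul n L).card ≤ (S1mul n M).card

theorem le_card_S1mul {n t : ℕ} (hmac : Mac n) (i : Fin (n + 1)) {A : ℕ → Finset (Fin n → ℕ)}
    (hA : ∀ j, IsLexSeg (degMon n (t - j)) (A j)) {M : Finset (Fin (n + 1) → ℕ)}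
    (hM : M ⊆ degMon (n + 1) t) (hc : ∀ j, (A j).card ≤ (slc M i j).card) :
    (S1mul n (A 0)).card +
      ∑ j ∈ range (t + 1), max (A j).card (S1mul n (A (j + 1))).card ≤
      (S1mul (n + 1) M).card := by
  rw [card_S1mul_slc hM i]
  apply add_le_add
  · exact hmac _ _ _ (hA 0) (slc_subset hM i 0) (hc 0)
  · apply Finset.sum_le_sum
    intro j _
    apply max_le
    · exact (hc j).trans (card_le_card subset_union_left)
    · exact (hmac _ _ _ (hA _) (slc_subset hM i _) (hc _)).trans (card_le_card subset_union_right)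

def Stab {n : ℕ} (M : Finset (Fin n → ℕ)) : Prop :=
  ∀ (m : Fin n → ℕ) (i j : Fin n), i < j → m + Pi.single j 1 ∈ M → m + Pi.single i 1 ∈ M

theorem lexLt_single {n : ℕ} (m : Fin n → ℕ) {i j : Fin n} (h : i < j) :
    lexLt (m + Pi.single j 1) (m + Pi.single i 1) := by
  refine ⟨i, ?_, ?_⟩
  · intro k hk
    simp [hk.ne, (hk.trans h).ne]
  · simp [h.ne]

theorem IsLexSeg.stab {n t : ℕ} {L : Finset (Fin n → ℕ)} (hL : IsLexSeg (degMon n t) L) :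
    Stab L := by
  intro m i j hij hm
  refine hL.2 _ hm _ ?_ (lexLt_single m hij)
  have := mem_degMon.1 (hL.1 hm)
  rw [sum_add_single] at this
  rw [mem_degMon, sum_add_single, this]

theorem Stab.card {n t : ℕ} {M : Finset (Fin (n + 1) → ℕ)} (hM : M ⊆ degMon (n + 1) t)
    (hs : Stab M) : (S1mul (n + 1) M).card = M.card + (S1mul n (slc M (Fin.last n) 0)).card := by
  rw [card_S1mul_slc hM (Fin.last n), card_slc hM (Fin.last n), add_comm]
  congr 1
  apply Finset.sum_congr rfl
  intro j _
  congr 1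
  rw [Finset.union_eq_left]
  intro u hu
  obtain ⟨k, m, hm, rfl⟩ := mem_S1mul.1 hu
  rw [mem_slc, insertNth_add_self] at hm
  rw [mem_slc, insertNth_add_single]
  apply hs _ _ _ _ hm
  simp [Fin.castSucc_lt_last]

theorem Stab.alpha {n : ℕ} {M : Finset (Fin (n + 2) → ℕ)} (hs : Stab M) :
    ∀ (a : ℕ) (u : Fin (n + 1) → ℕ), u ∈ slc M (Fin.last _) a →
      u + Pi.single (Fin.last n) a ∈ slc M (Fin.last _) 0 := by
  intro a
  induction a with
  | zero => intro u hu; simpa using hu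
  | succ a ih =>
    intro u hu
    have : u + Pi.single (Fin.last n) 1 ∈ slc M (Fin.last _) a := by
      rw [mem_slc, insertNth_add_self] at hu
      rw [mem_slc, insertNth_add_single]
      apply hs _ _ _ _ hu
      simp [Fin.castSucc_lt_last]
    have := ih _ this
    rwa [add_assoc, ← Pi.single_add, add_comm 1 a] at this

theorem key {n t : ℕ} {L M : Finset (Fin (n + 2) → ℕ)} (hL : IsLexSeg (degMon (n + 2) t) L)
    (hM : M ⊆ degMon (n + 2) t) (hs : Stab M)
    (h0 : IsLexSeg (degMon (n + 1) t) (slc M (Fin.last _) 0)) (hc : L.card ≤ M.card) :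
    slc L (Fin.last _) 0 ⊆ slc M (Fin.last _) 0 := by
  by_contra hcon
  obtain ⟨u, huL, huM⟩ := Finset.not_subset.1 hcon
  rw [mem_slc] at huL
  have hus := insertNth_mem_degMon.1 (hL.1 huL)
  have : M ⊆ L := by
    intro m hm
    obtain ⟨a, v, rfl⟩ : ∃ a v, m = (Fin.last (n + 1)).insertNth a v :=
      ⟨m (Fin.last _), (Fin.last _).removeNth m, by simp⟩
    have hvs := insertNth_mem_degMon.1 (hM hm)
    have hal := hs.alpha a v (mem_slc.2 hm)
    apply hL.2 _ huL _ (hM hm)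
    rcases lexLt_tri u (v + Pi.single (Fin.last n) a) with h | h | h
    · obtain ⟨p, hp, hlt⟩ := h
      have hpl : p < Fin.last n := by
        rw [Fin.lt_last_iff_ne_last]
        rintro rfl
        have e1 := sum_add_single v (Fin.last n) a
        rw [Fin.sum_univ_castSucc] at e1 hus
        have : ∑ i : Fin n, u i.castSucc = ∑ i : Fin n, (v + Pi.single (Fin.last n) a : _ → ℕ) i.castSucc :=
          Finset.sum_congr rfl (fun i _ => hp _ (Fin.castSucc_lt_last i))
        omega
      refine ⟨p.castSucc, ?_, ?_⟩
      · intro j hj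
        have hj' : j ≠ Fin.last _ := (hj.trans (Fin.castSucc_lt_last p)).ne
        obtain ⟨j', rfl⟩ := Fin.exists_castSucc_eq.2 hj'
        have hj2 : j' < p := hj
        have := hp j' hj2
        rw [Pi.add_apply, Pi.single_eq_of_ne (hj2.trans hpl).ne] at this
        simpa [Fin.insertNth_last'] using this
      · rw [Pi.add_apply, Pi.single_eq_of_ne hpl.ne] at hlt
        simpa [Fin.insertNth_last'] using hlt
    · exact absurd (h ▸ hal) huM
    · exact absurd (h0.2 _ hal u (mem_degMon.2 (by omega)) h) huM
  have := Finset.eq_of_subset_of_card_le this hc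
  rw [← this] at huL
  exact huM (mem_slc.2 huL)

theorem card_le_S1mul {n : ℕ} (M : Finset (Fin (n + 1) → ℕ)) :
    M.card ≤ (S1mul (n + 1) M).card := by
  rw [← card_image_of_injective M (add_left_injective (Pi.single (Fin.last n) 1 : Fin (n + 1) → ℕ))]
  apply card_le_card
  intro x hx
  obtain ⟨m, hm, rfl⟩ := mem_image.1 hx
  exact mem_S1mul.2 ⟨_, m, hm, rfl⟩

theorem card_lt_S1mul {n : ℕ} (M : Finset (Fin (n + 2) → ℕ)) (hM : M.Nonempty) :
    M.card < (S1mul (n + 2) M).card := by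
  rw [← card_image_of_injective M
    (add_left_injective (Pi.single (Fin.last (n + 1)) 1 : Fin (n + 2) → ℕ))]
  apply card_lt_card
  rw [Finset.ssubset_iff_of_subset]
  · obtain ⟨m, hm, hmin⟩ := Finset.exists_min_image M (fun m => m (Fin.last (n + 1))) hM
    refine ⟨m + Pi.single 0 1, mem_S1mul.2 ⟨_, m, hm, rfl⟩, ?_⟩
    intro h
    obtain ⟨m', hm', he⟩ := mem_image.1 h
    have h1 := hmin m' hm'
    have h2 := congrFun he (Fin.last (n + 1))
    simp at h2
    omega
  · intro x hx
    obtain ⟨m, hm, rfl⟩ := mem_image.1 hx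
    exact mem_S1mul.2 ⟨_, m, hm, rfl⟩

theorem degMon_zero_card (t : ℕ) : (degMon 0 t).card ≤ 1 := by
  apply Finset.card_le_one.2
  intro a _ b _
  exact Subsingleton.elim _ _

theorem degMon_one_card (t : ℕ) : (degMon 1 t).card = 1 := by
  simp [degMon]

theorem mac_zero : Mac 0 := by
  intro t L M _ _ _
  have : S1mul 0 L = ∅ := by ext x; simp [mem_S1mul]
  simp [this]

theorem mac_one : Mac 1 := by
  intro t L M hL _ hc
  rw [hL.stab.card hL.1]
  have : S1mul 0 (slc L (Fin.last 0) 0) = ∅ := by ext x; simp [mem_S1mul]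
  rw [this]
  simpa using hc.trans (card_le_S1mul M)

theorem mac_two : Mac 2 := by
  intro t L M hL _ hc
  rcases M.eq_empty_or_nonempty with rfl | hne
  · have : L = ∅ := by simpa using hc
    rw [this]
  rw [hL.stab.card hL.1]
  have h1 : M.card < (S1mul 2 M).card := card_lt_S1mul (n := 0) M hne
  have h2 := card_le_card (S1mul_subset (slc_subset hL.1 (Fin.last 1) 0))
  rw [degMon_one_card] at h2
  omega

theorem exchange {n : ℕ} {G L A : Finset (Fin n → ℕ)} (hL : IsLexSeg G L) (hA : A ⊆ G)
    (hc : L.card = A.card) (w : (Fin n → ℕ) → ℕ)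
    (hw : ∀ a ∈ G, ∀ b ∈ G, lexLt a b → w b < w a) (hne : L ≠ A) :
    ∑ x ∈ L, w x < ∑ x ∈ A, w x := by
  have hcard : (L \ A).card = (A \ L).card := by
    have h1 := card_sdiff_add_card_inter L A
    have h2 := card_sdiff_add_card_inter A L
    rw [inter_comm A L] at h2
    omega
  have hpos : 0 < (A \ L).card := by
    rw [card_pos, Finset.sdiff_nonempty]
    intro h
    exact hne (Finset.eq_of_subset_of_card_le h hc.le).symm
  have hlt : ∀ b ∈ L \ A, ∀ a ∈ A \ L, w b < w a := by
    intro b hb a ha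
    rw [mem_sdiff] at hb ha
    rcases lexLt_tri a b with h | h | h
    · exact hw a (hA ha.1) b (hL.1 hb.1) h
    · exact absurd (h ▸ ha.1) hb.2
    · exact absurd (hL.2 b hb.1 a (hA ha.1) h) ha.2
  have h1 : ∑ x ∈ L \ A, w x ≤ _ := Finset.sum_le_card_nsmul (L \ A) w ((L \ A).sup w) (fun x hx => Finset.le_sup hx)
  have h2 : _ ≤ ∑ x ∈ A \ L, w x := Finset.card_nsmul_le_sum (A \ L) w ((L \ A).sup w + 1) (by
    intro a ha
    obtain ⟨b, hb, he⟩ := Finset.exists_mem_eq_sup (L \ A) (card_pos.1 (by omega)) w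
    rw [he]; exact hlt b hb a ha)
  have h3 : _ + ∑ x ∈ L \ A, w x = ∑ x ∈ L, w x := Finset.sum_inter_add_sum_sdiff L A w
  have h4 : _ + ∑ x ∈ A \ L, w x = ∑ x ∈ A, w x := Finset.sum_inter_add_sum_sdiff A L w
  rw [inter_comm A L] at h4
  rw [smul_eq_mul] at h1 h2
  rw [hcard] at h1
  rw [mul_add] at h2
  omega

/-- compression -/
def cpr {n : ℕ} (t : ℕ) (i : Fin (n + 1)) (M : Finset (Fin (n + 1) → ℕ)) :
    Finset (Fin (n + 1) → ℕ) :=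
  bld t i (fun j => lexSeg (degMon n (t - j)) (slc M i j).card)

theorem cpr_subset {n : ℕ} (t : ℕ) (i : Fin (n + 1)) (M : Finset (Fin (n + 1) → ℕ)) :
    cpr t i M ⊆ degMon (n + 1) t := bld_subset _ _ _

theorem lexSeg_card_slc {n t : ℕ} {M : Finset (Fin n → ℕ)} (hM : M ⊆ degMon n t) :
    (lexSeg (degMon n t) M.card).card = M.card := by
  rw [lexSeg_card]; exact min_eq_left (card_le_card hM)

theorem lexSeg_zero {n : ℕ} (G : Finset (Fin n → ℕ)) : lexSeg G 0 = ∅ := by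
  rw [← Finset.card_eq_zero, lexSeg_card]; simp

theorem slc_cpr {n t : ℕ} (i : Fin (n + 1)) (M : Finset (Fin (n + 1) → ℕ)) {j : ℕ} (hj : j ≤ t) :
    slc (cpr t i M) i j = lexSeg (degMon n (t - j)) (slc M i j).card :=
  slc_bld (A := fun j => lexSeg (degMon n (t - j)) (slc M i j).card) i hj (lexSeg_isLexSeg _ _).1

theorem card_cpr {n t : ℕ} (i : Fin (n + 1)) {M : Finset (Fin (n + 1) → ℕ)}
    (hM : M ⊆ degMon (n + 1) t) : (cpr t i M).card = M.card := by
  rw [card_slc hM i, card_slc (cpr_subset t i M) i]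
  apply Finset.sum_congr rfl
  intro j hj
  have hj : j ≤ t := by simp at hj; omega
  rw [slc_cpr i M hj, lexSeg_card_slc (slc_subset hM _ _)]

theorem card_S1mul_cpr {n t : ℕ} (hmac : Mac n) (i : Fin (n + 1)) {M : Finset (Fin (n + 1) → ℕ)}
    (hM : M ⊆ degMon (n + 1) t) :
    (S1mul (n + 1) (cpr t i M)).card ≤ (S1mul (n + 1) M).card := by
  rw [cpr, card_S1mul_bld]
  · apply le_card_S1mul hmac i (A := fun j => lexSeg (degMon n (t - j)) (slc M i j).card) _ hM
    · intro j; exact (lexSeg_card_slc (slc_subset hM _ _)).le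
    · intro j; exact lexSeg_isLexSeg _ _
  · intro j; exact lexSeg_isLexSeg _ _
  · rw [slc_empty hM _ _ (Nat.lt_succ_self t), card_empty, lexSeg_zero]

theorem sum_cpr_lt {n t : ℕ} (i : Fin (n + 1)) {M : Finset (Fin (n + 1) → ℕ)}
    (hM : M ⊆ degMon (n + 1) t) (w : (Fin (n + 1) → ℕ) → ℕ)
    (hw : ∀ a ∈ degMon (n + 1) t, ∀ b ∈ degMon (n + 1) t, lexLt a b → w b < w a)
    (hne : ∃ j, j ≤ t ∧ ¬ IsLexSeg (degMon n (t - j)) (slc M i j)) :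
    ∑ x ∈ cpr t i M, w x < ∑ x ∈ M, w x := by
  rw [sum_slc hM i, sum_slc (cpr_subset t i M) i]
  have hstrict : ∀ j, j ≤ t → ¬ IsLexSeg (degMon n (t - j)) (slc M i j) →
      ∑ u ∈ slc (cpr t i M) i j, w (i.insertNth j u) < ∑ u ∈ slc M i j, w (i.insertNth j u) := by
    intro j hj hn
    rw [slc_cpr i M hj]
    apply exchange (lexSeg_isLexSeg _ _) (slc_subset hM i j) (lexSeg_card_slc (slc_subset hM i j))
      (fun u => w (i.insertNth j u))
    · intro a ha b hb hab
      rw [mem_degMon] at ha hb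
      exact hw _ (insertNth_mem_degMon.2 (by omega)) _ (insertNth_mem_degMon.2 (by omega))
        ((lexLt_insertNth _ _ _ _).2 hab)
    · intro h
      exact hn (h ▸ lexSeg_isLexSeg _ _)
  apply Finset.sum_lt_sum
  · intro j hj
    have hj : j ≤ t := by simp at hj; omega
    by_cases h : IsLexSeg (degMon n (t - j)) (slc M i j)
    · rw [slc_cpr i M hj, ← h.eq_lexSeg]
    · exact (hstrict j hj h).le
  · obtain ⟨j, hj, hn⟩ := hne
    exact ⟨j, by simp; omega, hstrict j hj hn⟩

theorem compressed_stab {n t : ℕ} {M : Finset (Fin (n + 3) → ℕ)}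
    (hM : M ⊆ degMon (n + 3) t)
    (h : ∀ i j, j ≤ t → IsLexSeg (degMon (n + 2) (t - j)) (slc M i j)) : Stab M := by
  intro m i j hij hm
  obtain ⟨k, hki, hkj⟩ : ∃ k : Fin (n + 3), k ≠ i ∧ k ≠ j := by
    have : ∃ k ∈ (univ : Finset (Fin (n + 3))), k ∉ ({i, j} : Finset (Fin (n + 3))) := by
      apply Finset.exists_mem_notMem_of_card_lt_card
      have := Finset.card_le_two (a := i) (b := j)
      simp; omega
    obtain ⟨k, _, hk⟩ := this
    simp at hk
    exact ⟨k, hk.1, hk.2⟩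
  obtain ⟨i', rfl⟩ := Fin.exists_succAbove_eq hki.symm
  obtain ⟨j', rfl⟩ := Fin.exists_succAbove_eq hkj.symm
  have hij' : i' < j' := (Fin.strictMono_succAbove k).lt_iff_lt.1 hij
  have e : m = k.insertNth (m k) (k.removeNth m) := by simp
  rw [e, ← insertNth_add_single] at hm ⊢
  have hd := insertNth_mem_degMon.1 (hM hm)
  rw [← mem_slc] at hm ⊢
  exact (h k (m k) (by omega)).stab _ _ _ hij' hm

theorem mac_succ (n : ℕ) (hmac : Mac (n + 2)) : Mac (n + 3) := by
  intro t L M hL hM hc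
  let w : (Fin (n + 3) → ℕ) → ℕ := fun m => ((degMon (n + 3) t).filter (fun v => lexLt m v)).card
  have hw : ∀ a ∈ degMon (n + 3) t, ∀ b ∈ degMon (n + 3) t, lexLt a b → w b < w a := by
    intro a _ b hb hab
    apply card_lt_card
    rw [Finset.ssubset_iff_of_subset]
    · exact ⟨b, by simp [hb, hab], by simp [lexLt_irrefl]⟩
    · intro x hx
      simp only [mem_filter] at hx ⊢
      exact ⟨hx.1, lexLt_trans hab hx.2⟩
  induction hN : ∑ x ∈ M, w x using Nat.strong_induction_on generalizing M with
  | _ N ih =>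
    by_cases hcomp : ∀ i j, j ≤ t → IsLexSeg (degMon (n + 2) (t - j)) (slc M i j)
    · have hs := compressed_stab hM hcomp
      rw [hL.stab.card hL.1, hs.card hM]
      apply add_le_add hc
      apply card_le_card
      apply S1mul_mono
      exact key hL hM hs (hcomp (Fin.last _) 0 (Nat.zero_le _)) hc
    · push Not at hcomp
      obtain ⟨i, j, hj, hn⟩ := hcomp
      have h1 := sum_cpr_lt i hM w hw ⟨j, hj, hn⟩
      have h2 := card_S1mul_cpr hmac i hM
      exact (ih _ (hN ▸ h1) (cpr t i M) (bld_subset _ _ _) (by rw [card_cpr i hM]; exact hc)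
        rfl).trans h2

theorem mac_all : ∀ n, Mac n
  | 0 => mac_zero
  | 1 => mac_one
  | 2 => mac_two
  | n + 3 => mac_succ n (mac_all (n + 2))

theorem g_succ {k t d : ℕ} (hd : d ≤ (degMon (k + 1) t).card) :
    d ≤ (degMon (k + 1) (t + 1)).card ∧
    (S1mul (k + 1) (lexSeg (degMon (k + 1) (t + 1)) d)).card =
      (S1mul (k + 1) (lexSeg (degMon (k + 1) t) d)).card := by
  have hinj := add_left_injective (Pi.single 0 1 : Fin (k + 1) → ℕ)
  set L := lexSeg (degMon (k + 1) t) d with hLdef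
  have hL : IsLexSeg (degMon (k + 1) t) L := lexSeg_isLexSeg _ _
  have hLc : L.card = d := by rw [hLdef, lexSeg_card]; exact min_eq_left hd
  have hX : IsLexSeg (degMon (k + 1) (t + 1)) (L.image (· + Pi.single 0 1)) := by
    constructor
    · intro x hx
      obtain ⟨m, hm, rfl⟩ := mem_image.1 hx
      rw [mem_degMon, sum_add_single, mem_degMon.1 (hL.1 hm)]
    · intro x hx v hv hlt
      obtain ⟨m, hm, rfl⟩ := mem_image.1 hx
      have hv0 : 0 < v 0 := by
        obtain ⟨p, hp, hpl⟩ := hlt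
        rcases eq_or_ne p 0 with rfl | h
        · omega
        · have := hp 0 (Fin.pos_of_ne_zero h)
          simp at this; omega
      obtain ⟨m', rfl⟩ : ∃ m' : Fin (k + 1) → ℕ, v = m' + Pi.single 0 1 := by
        refine ⟨v - Pi.single 0 1, ?_⟩
        funext j
        by_cases hj : j = 0
        · subst hj; simp; omega
        · simp [hj]
      refine mem_image.2 ⟨m', hL.2 m hm m' ?_ ?_, rfl⟩
      · rw [mem_degMon, sum_add_single] at hv
        rw [mem_degMon]; omega
      · obtain ⟨p, hp, hpl⟩ := hlt
        refine ⟨p, fun j hj => ?_, ?_⟩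
        · simpa using hp j hj
        · simpa using hpl
  have hXc : (L.image (· + (Pi.single 0 1 : Fin (k + 1) → ℕ))).card = d := by
    rw [card_image_of_injective _ hinj, hLc]
  refine ⟨hXc ▸ card_le_card hX.1, ?_⟩
  have e := hX.eq_lexSeg
  rw [hXc] at e
  rw [← e]
  have : S1mul (k + 1) (L.image (· + Pi.single 0 1)) =
      (S1mul (k + 1) L).image (· + Pi.single 0 1) := by
    ext x
    simp only [mem_S1mul, mem_image]
    constructor
    · rintro ⟨l, _, ⟨m, hm, rfl⟩, rfl⟩
      exact ⟨_, ⟨l, m, hm, rfl⟩, by rw [add_right_comm]⟩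
    · rintro ⟨_, ⟨l, m, hm, rfl⟩, rfl⟩
      exact ⟨l, _, ⟨m, hm, rfl⟩, by rw [add_right_comm]⟩
  rw [this, card_image_of_injective _ hinj]

theorem g_add {k t d : ℕ} (s : ℕ) (hd : d ≤ (degMon (k + 1) t).card) :
    d ≤ (degMon (k + 1) (t + s)).card ∧
    (S1mul (k + 1) (lexSeg (degMon (k + 1) (t + s)) d)).card =
      (S1mul (k + 1) (lexSeg (degMon (k + 1) t) d)).card := by
  induction s with
  | zero => exact ⟨hd, rfl⟩
  | succ s ih =>
    have := g_succ ih.1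
    exact ⟨this.1, this.2.trans ih.2⟩

theorem le_degMon_card (k d : ℕ) : d + 1 ≤ (degMon (k + 2) d).card := by
  rw [card_slc (subset_refl (degMon (k + 2) d)) 0]
  calc d + 1 = ∑ j ∈ range (d + 1), 1 := by simp
    _ ≤ _ := by
      apply Finset.sum_le_sum
      intro j hj
      have hj : j ≤ d := by simp at hj; omega
      apply card_pos.2
      refine ⟨Pi.single 0 (d - j), ?_⟩
      rw [mem_slc, insertNth_mem_degMon]
      simp; omega

theorem growth_eq {k t d : ℕ} (hd : d ≤ (degMon (k + 1) t).card) :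
    growth d k = (S1mul (k + 1) (lexSeg (degMon (k + 1) t) d)).card := by
  have hd' : d ≤ (degMon (k + 1) d).card := by
    cases k with
    | zero => rw [degMon_one_card] at *; exact hd
    | succ k => exact (Nat.le_succ d).trans (le_degMon_card k d)
  rw [growth, ← (g_add t hd').2, ← (g_add d hd).2, add_comm d t]

theorem card_comp {k : ℕ} (M : Finset (Fin (k + 2) → ℕ)) (j : ℕ) :
    (comp M j).card = (slc M 0 j).card := by
  rw [slc, card_image_of_injOn]
  · rfl
  · intro a ha b hb hab
    simp at ha hb hab
    have e1 : a = (0 : Fin (k + 2)).insertNth (a 0) ((0 : Fin (k + 2)).removeNth a) := by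
      rw [Fin.insertNth_self_removeNth]
    have e2 : b = (0 : Fin (k + 2)).insertNth (b 0) ((0 : Fin (k + 2)).removeNth b) := by
      rw [Fin.insertNth_self_removeNth]
    rw [e1, e2, ha.2, hb.2]
    congr 1

/-- Let `M` be a Gotzmann set of degree-`t` monomials in `S`, and
`d_i = |M^i|`.  If `d_q^{<n-2>} < d_{q-1}` for some `1 ≤ q ≤ t`, then either
`(d_q + 1)^{<n-2>} > d_{q-1} - 1` or `d_q + 1 > d_{q+1}^{<n-2>}`. -/
theorem stmt_11 (n t q : ℕ) (hn : 2 ≤ n) (M : Finset (Fin n → ℕ)) (hM : M ⊆ degMon n t)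
    (hG : GotzmannS n t M) (hq1 : 1 ≤ q) (hqt : q ≤ t)
    (hcond : growth ((comp M q).card) (n - 2) < (comp M (q - 1)).card) :
    (comp M (q - 1)).card - 1 < growth ((comp M q).card + 1) (n - 2) ∨
      growth ((comp M (q + 1)).card) (n - 2) < (comp M q).card + 1 := by
  obtain ⟨k, rfl⟩ : ∃ k, n = k + 2 := ⟨n - 2, by omega⟩
  obtain ⟨p, rfl⟩ : ∃ p, q = p + 1 := ⟨q - 1, by omega⟩
  simp only [Nat.add_sub_cancel, card_comp] at hcond ⊢
  by_contra hcon
  push Not at hcon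
  obtain ⟨hc1, hc2⟩ := hcon
  set d : ℕ → ℕ := fun j => (slc M 0 j).card with hd
  have hdj : ∀ j, (slc M 0 j).card = d j := fun j => rfl
  simp only [hdj] at hcond hc1 hc2
  have hdle : ∀ j, d j ≤ (degMon (k + 1) (t - j)).card := fun j => card_le_card (slc_subset hM 0 j)
  have hd0 : d (t + 1) = 0 := by
    rw [← hdj, slc_empty hM _ _ (Nat.lt_succ_self t), card_empty]
  have hg0 : growth 0 k = 0 := by
    rw [growth_eq (t := 0) (Nat.zero_le _), lexSeg_zero, S1mul_empty, card_empty]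
  have hpt : p + 2 ≤ t := by
    by_contra h
    have : p + 1 + 1 = t + 1 := by omega
    rw [this, hd0, hg0] at hc2
    omega
  set A : ℕ → Finset (Fin (k + 1) → ℕ) := fun j => lexSeg (degMon (k + 1) (t - j)) (d j) with hA
  have hAc : ∀ j, (A j).card = d j := fun j => by
    rw [hA]; simp only [lexSeg_card]; exact min_eq_left (hdle j)
  have hAl : ∀ j, IsLexSeg (degMon (k + 1) (t - j)) (A j) := fun j => lexSeg_isLexSeg _ _
  have hgA : ∀ j, growth (d j) k = (S1mul (k + 1) (A j)).card := fun j => growth_eq (hdle j)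
  set d' : ℕ → ℕ := fun j => if j = p then d p - 1 else if j = p + 1 then d (p + 1) + 1 else d j
    with hd'
  have hd'p : d' p = d p - 1 := by simp [hd']
  have hd'q : d' (p + 1) = d (p + 1) + 1 := by simp [hd']
  have hd'o : ∀ j, j ≠ p → j ≠ p + 1 → d' j = d j := fun j h1 h2 => by simp [hd', h1, h2]
  have hd'le : ∀ j, d' j ≤ (degMon (k + 1) (t - j)).card := by
    intro j
    by_cases h1 : j = p
    · subst h1; rw [hd'p]; exact (Nat.sub_le _ _).trans (hdle _)
    by_cases h2 : j = p + 1
    · subst h2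
      rw [hd'q]
      refine hc2.trans ?_
      rw [hgA]
      refine (card_le_card (S1mul_subset (hAl _).1)).trans (le_of_eq ?_)
      congr 2; omega
    · rw [hd'o j h1 h2]; exact hdle j
  set A' : ℕ → Finset (Fin (k + 1) → ℕ) := fun j => lexSeg (degMon (k + 1) (t - j)) (d' j) with hA'
  have hA'c : ∀ j, (A' j).card = d' j := fun j => by
    rw [hA']; simp only [lexSeg_card]; exact min_eq_left (hd'le j)
  have hA'l : ∀ j, IsLexSeg (degMon (k + 1) (t - j)) (A' j) := fun j => lexSeg_isLexSeg _ _
  have hgA' : ∀ j, growth (d' j) k = (S1mul (k + 1) (A' j)).card := fun j => growth_eq (hd'le j)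
  have hA'0 : A' (t + 1) = ∅ := by
    rw [← Finset.card_eq_zero, hA'c, hd'o _ (by omega) (by omega), hd0]
  have hmono : ∀ j, j ≠ p + 1 → (S1mul (k + 1) (A' j)).card ≤ (S1mul (k + 1) (A j)).card := by
    intro j hj
    apply card_le_card
    apply S1mul_mono
    apply (hA'l j).subset_of_card (hAl j)
    rw [hAc, hA'c]
    by_cases h1 : j = p
    · subst h1; omega
    · exact (hd'o j h1 hj).le
  have hdp : 1 ≤ d p := by omega
  have hcard : (bld t 0 A').card = M.card := by
    rw [card_slc (bld_subset t 0 A') 0, card_slc hM 0]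
    have e1 : ∀ j ∈ range (t + 1), (slc (bld t 0 A') 0 j).card + (if j = p then 1 else 0)
        = (slc M 0 j).card + (if j = p + 1 then 1 else 0) := by
      intro j hj
      have hj : j ≤ t := by simp at hj; omega
      rw [slc_bld 0 hj (hA'l j).1, hA'c, hdj]
      by_cases h1 : j = p
      · subst h1; rw [hd'p]; simp; omega
      by_cases h2 : j = p + 1
      · subst h2; rw [hd'q]; simp
      · rw [hd'o j h1 h2]; simp [h1, h2]
    have e2 := Finset.sum_congr rfl e1
    rw [Finset.sum_add_distrib, Finset.sum_add_distrib, Finset.sum_ite_eq', Finset.sum_ite_eq',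
      if_pos (by simp; omega), if_pos (by simp; omega)] at e2
    omega
  have hlow := le_card_S1mul (mac_all (k + 1)) 0 hAl hM (fun j => (hAc j).le)
  have hup := card_S1mul_bld 0 hA'l hA'0
  have hsum : ∑ j ∈ range (t + 1), max (A' j).card (S1mul (k + 1) (A' (j + 1))).card + 1 ≤
      ∑ j ∈ range (t + 1), max (A j).card (S1mul (k + 1) (A (j + 1))).card := by
    have e1 : ∀ j ∈ range (t + 1), max (A' j).card (S1mul (k + 1) (A' (j + 1))).card
        + (if j = p then 1 else 0) ≤ max (A j).card (S1mul (k + 1) (A (j + 1))).card := by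
      intro j _
      rw [hAc, hA'c]
      by_cases h1 : j = p
      · subst h1
        rw [← hgA', hd'p, hd'q, if_pos rfl, max_eq_left hc1]
        exact le_trans (by omega) (le_max_left _ _)
      have hm := hmono (j + 1) (by omega)
      rw [if_neg h1, add_zero]
      by_cases h2 : j = p + 1
      · subst h2
        rw [hd'q]
        rw [← hgA (p + 1 + 1)] at hm ⊢
        exact (max_le hc2 hm).trans (le_max_right _ _)
      · rw [hd'o j h1 h2]
        exact max_le_max le_rfl hm
    have e2 := Finset.sum_le_sum e1
    rwa [Finset.sum_add_distrib, Finset.sum_ite_eq', if_pos (by simp; omega)] at e2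
  have hz := hmono 0 (by omega)
  have hmacB := mac_all (k + 2) t (lexSeg (degMon (k + 2) t) M.card) (bld t 0 A')
    (lexSeg_isLexSeg _ _) (bld_subset _ _ _) (by rw [lexSeg_card, hcard]; exact min_le_left _ _)
  rw [GotzmannS] at hG
  have hG' : (S1mul (k + 1 + 1) M).card = _ := hG.symm
  have hup' : (S1mul (k + 2) (bld t 0 A')).card = _ := hup
  omega
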